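/- There do not exist five points in Euclidean 3-space that are pairwise at distance 1; that is, there is no map f : Fin 5 → ℝ³ such that ‖f(i) − f(j)‖ = 1 for all i ≠ j. -/

import Mathlib

/-- There do not exist five points in Euclidean 3-space that are pairwise at
distance `1`. -/
theorem no_five_equidistant_points_in_R3 :
    ¬ ∃ f : Fin 5 → EuclideanSpace ℝ (Fin 3),
        ∀ i j : Fin 5, i ≠ j → ‖f i - f j‖ = 1 := by
  rintro ⟨f, hf⟩
  have hself : ∀ i : Fin 4, inner ℝ (f i.succ - f 0) (f i.succ - f 0) = (1 : ℝ) := by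
    intro i
    rw [real_inner_self_eq_norm_sq, hf _ _ (Fin.succ_ne_zero i)]
    norm_num
  have hne : ∀ i j : Fin 4, i ≠ j →
      inner ℝ (f i.succ - f 0) (f j.succ - f 0) = (1 / 2 : ℝ) := by
    intro i j hij
    have h := norm_sub_sq_real (f i.succ - f 0) (f j.succ - f 0)
    rw [sub_sub_sub_cancel_right, hf _ _ (Fin.succ_ne_zero i), hf _ _ (Fin.succ_ne_zero j),
      hf _ _ (fun h => hij (Fin.succ_injective _ h))] at h
    linarith
  have hli : LinearIndependent ℝ (fun i : Fin 4 => f i.succ - f 0) := by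
    rw [Fintype.linearIndependent_iff]
    intro g hg
    have key : ∀ j : Fin 4, g j / 2 + (∑ i, g i) / 2 = 0 := by
      intro j
      have h := congrArg (fun x => inner ℝ x (f j.succ - f 0)) hg
      simp only [sum_inner, real_inner_smul_left, inner_zero_left] at h
      have h2 : ∀ i : Fin 4, g i * inner ℝ (f i.succ - f 0) (f j.succ - f 0)
          = g i / 2 + (if i = j then g i / 2 else 0) := by
        intro i
        split_ifs with hij
        · subst hij
          rw [hself]; ring
        · rw [hne i j hij]; ring
      simp only [h2, Finset.sum_add_distrib, Finset.sum_ite_eq', Finset.mem_univ, if_true,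
        Finset.sum_ite_eq, ← Finset.sum_div] at h
      linarith
    have k0 := key 0
    have k1 := key 1
    have k2 := key 2
    have k3 := key 3
    simp only [Fin.sum_univ_four] at k0 k1 k2 k3
    intro i
    fin_cases i <;> simp <;> linarith
  have := hli.fintype_card_le_finrank
  simp at this
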